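/- Let d ≥ 2 and let H be a finite subgroup of ℝ/ℤ or of ℝ/ℤ × ℤ₂ of order n (so H is isomorphic to ℤ_n, or to ℤ_{n/2} × ℤ₂ when 4 divides n). Then for every c ∈ H, [2, 1, …, 1; c] (with d−1 ones) equals (d−1)!·(binom(n−1, d−1) + ε(d, n)), where |ε(d, n)| = O(2^{−d/2}·binom(n, (d−1)/2) + binom(n, (d−3)/2)) if d is odd, and |ε(d, n)| = O(d·2^{−d/2}·binom(n, d/2−1) + binom(n, d/2−2)) if d is even. -/

import Mathlib

open Finset

section Tuples
variable {H : Type*} [Fintype H] [DecidableEq H]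

/-- The number of injective tuples with a given image is the factorial of its size. -/
theorem card_injective_tuples_image_eq {j : ℕ} {s : Finset H} (hs : #s = j) :
    #{a : Fin j → H | Function.Injective a ∧ univ.image a = s} = j.factorial := by
  subst hs
  have hcard : (#s).factorial = #(univ : Finset (Fin #s ≃ s)) := by
    rw [card_univ, Fintype.card_equiv s.equivFin.symm, Fintype.card_fin]
  rw [hcard]
  symm
  refine Finset.card_bij (fun e _ i => (e i : H)) ?_ ?_ ?_
  · intro e _
    simp only [mem_filter, mem_univ, true_and]
    refine ⟨Subtype.val_injective.comp e.injective, ?_⟩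
    ext x
    simp only [mem_image, mem_univ, true_and]
    constructor
    · rintro ⟨i, rfl⟩; exact (e i).2
    · intro hx; exact ⟨e.symm ⟨x, hx⟩, by simp⟩
  · intro e _ e' _ h
    ext i
    exact congrFun h i
  · intro a ha
    simp only [mem_filter, mem_univ, true_and] at ha
    obtain ⟨hinj, him⟩ := ha
    have hmem : ∀ i, a i ∈ s := fun i => him ▸ mem_image_of_mem a (mem_univ i)
    refine ⟨Equiv.ofBijective (fun i => (⟨a i, hmem i⟩ : s)) ⟨?_, ?_⟩, mem_univ _, rfl⟩
    · intro x y hxy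
      exact hinj (congrArg Subtype.val hxy)
    · rintro ⟨x, hx⟩
      rw [← him] at hx
      obtain ⟨i, -, hi⟩ := mem_image.1 hx
      exact ⟨i, Subtype.ext hi⟩

theorem card_injective_tuples (j : ℕ) :
    #{a : Fin j → H | Function.Injective a} = (Fintype.card H).descFactorial j := by
  rw [← Fintype.card_subtype, Fintype.card_congr (Equiv.subtypeInjectiveEquivEmbedding _ _),
    Fintype.card_embedding_eq, Fintype.card_fin]

variable [AddCommGroup H]

/-- Counting injective tuples of given sum reduces to counting subsets of given sum. -/
theorem card_injective_tuples_sum_eq (j : ℕ) (c : H) :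
    #{a : Fin j → H | Function.Injective a ∧ ∑ i, a i = c} =
      j.factorial * #{s ∈ powersetCard j (univ : Finset H) | ∑ x ∈ s, x = c} := by
  rw [card_eq_sum_card_fiberwise (f := fun a : Fin j → H => univ.image a)
    (t := {s ∈ powersetCard j (univ : Finset H) | ∑ x ∈ s, x = c})]
  · rw [mul_comm, ← smul_eq_mul, ← sum_const]
    refine sum_congr rfl fun s hs => ?_
    simp only [mem_filter, mem_powersetCard, subset_univ, true_and] at hs
    rw [← card_injective_tuples_image_eq hs.1, filter_filter]
    congr 1
    ext a
    simp only [mem_filter, mem_univ, true_and]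
    refine ⟨fun h => ⟨h.1.1, h.2⟩, fun h => ⟨⟨h.1, ?_⟩, h.2⟩⟩
    rw [← hs.2, ← h.2, sum_image fun x _ y _ hxy => h.1 hxy]
  · intro a ha
    simp only [coe_filter, mem_univ, true_and, Set.mem_ofPred_eq, mem_powersetCard,
      subset_univ] at ha ⊢
    rw [card_image_of_injective _ ha.1, sum_image fun x _ y _ hxy => ha.1 hxy]
    exact ⟨by simp, ha.2⟩

/-- The position of the doubled entry does not matter. -/
theorem card_injective_tuples_doubled_eq {d : ℕ} (i j : Fin d) (c : H) :
    #{a : Fin d → H | Function.Injective a ∧ a i + ∑ k, a k = c} =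
      #{a : Fin d → H | Function.Injective a ∧ a j + ∑ k, a k = c} := by
  have key : ∀ i j : Fin d, ∀ a : Fin d → H, (Function.Injective a ∧ a i + ∑ k, a k = c) →
      (Function.Injective (a ∘ Equiv.swap i j) ∧
        (a ∘ Equiv.swap i j) j + ∑ k, (a ∘ Equiv.swap i j) k = c) := by
    intro i j a ha
    refine ⟨ha.1.comp (Equiv.injective _), ?_⟩
    rw [← ha.2]
    simp only [Function.comp_apply, Equiv.swap_apply_right]
    rw [Equiv.sum_comp (Equiv.swap i j) a]
  refine card_nbij' (fun a => a ∘ Equiv.swap i j) (fun a => a ∘ Equiv.swap i j) ?_ ?_ ?_ ?_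
  · intro a ha
    simpa using key i j a (by simpa using ha)
  · intro a ha
    have := key j i a (by simpa using ha)
    rw [Equiv.swap_comm] at this
    simpa using this
  · intro a _
    funext k
    simp
  · intro a _
    funext k
    simp

/-- Extending an injective `d`-tuple by the entry that makes the sum `c` either gives an
injective tuple or repeats exactly one entry. -/
theorem descFactorial_eq_card_add_mul_card {d : ℕ} (i : Fin d) (c : H) :
    (Fintype.card H).descFactorial d =
      #{a : Fin (d + 1) → H | Function.Injective a ∧ ∑ k, a k = c} +
        d * #{a : Fin d → H | Function.Injective a ∧ a i + ∑ k, a k = c} := by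
  rw [← card_injective_tuples,
    ← card_filter_add_card_filter_not (fun a : Fin d → H => c - ∑ k, a k ∉ Set.range a)]
  congr 1
  · refine card_nbij' (fun a => Fin.cons (c - ∑ k, a k) a) (fun a => Fin.tail a) ?_ ?_ ?_ ?_
    · intro a ha
      simp only [coe_filter, mem_filter, mem_univ, true_and, Set.mem_ofPred_eq] at ha ⊢
      refine ⟨Fin.cons_injective_iff.2 ⟨ha.2, ha.1⟩, ?_⟩
      simp [Fin.sum_univ_succ]
    · intro a ha
      simp only [coe_filter, mem_filter, mem_univ, true_and, Set.mem_ofPred_eq] at ha ⊢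
      obtain ⟨h1, h2⟩ := ha
      rw [← Fin.cons_self_tail a, Fin.cons_injective_iff] at h1
      refine ⟨h1.2, ?_⟩
      have : c - ∑ k, Fin.tail a k = a 0 := by
        rw [← h2, Fin.sum_univ_succ]
        simp [Fin.tail]
      rw [this]
      exact h1.1
    · intro a _
      simp
    · intro a ha
      simp only [coe_filter, mem_univ, true_and, Set.mem_ofPred_eq] at ha
      have : c - ∑ k, Fin.tail a k = a 0 := by
        rw [← ha.2, Fin.sum_univ_succ]
        simp [Fin.tail]
      simp only [this, Fin.cons_self_tail]
  · have hU : ({a ∈ {a : Fin d → H | Function.Injective a} |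
          ¬ (c - ∑ k, a k ∉ Set.range a)} : Finset (Fin d → H)) =
        univ.biUnion fun i : Fin d =>
          {a : Fin d → H | Function.Injective a ∧ a i + ∑ k, a k = c} := by
      ext a
      simp only [mem_filter, mem_univ, true_and, not_not, Set.mem_range, mem_biUnion,
        eq_sub_iff_add_eq]
      exact ⟨fun ⟨h, i, hi⟩ => ⟨i, h, hi⟩, fun ⟨i, h, hi⟩ => ⟨h, i, hi⟩⟩
    rw [hU, card_biUnion]
    · rw [sum_congr rfl fun k _ => card_injective_tuples_doubled_eq k i c]
      simp
    · intro k _ l _ hkl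
      refine Finset.disjoint_left.2 fun a ha hb => ?_
      simp only [mem_filter, mem_univ, true_and] at ha hb
      exact hkl (ha.1 (add_right_cancel (ha.2.trans hb.2.symm)))

end Tuples

section Characters

variable {H : Type*} [AddCommGroup H] [Fintype H]

/-- Fourier inversion for the number of `j`-subsets with sum `c`. -/
theorem card_mul_card_powersetCard_sum_eq [DecidableEq H] (j : ℕ) (c : H) :
    (Fintype.card H : ℂ) * #{s ∈ powersetCard j (univ : Finset H) | ∑ x ∈ s, x = c} =
      ∑ ψ : AddChar H ℂ, ψ (-c) * ∑ s ∈ powersetCard j (univ : Finset H), ∏ x ∈ s, ψ x := by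
  have hprod : ∀ (ψ : AddChar H ℂ) (s : Finset H), ∏ x ∈ s, ψ x = ψ (∑ x ∈ s, x) := by
    intro ψ s
    induction s using Finset.induction_on with
    | empty => simp
    | insert a s ha ih => rw [prod_insert ha, sum_insert ha, ih, AddChar.map_add_eq_mul]
  simp_rw [mul_sum, hprod, ← AddChar.map_add_eq_mul]
  rw [sum_comm]
  simp_rw [AddChar.sum_apply_eq_ite]
  rw [card_filter]
  push_cast
  rw [mul_sum]
  refine sum_congr rfl fun s _ => ?_
  simp only [neg_add_eq_zero, eq_comm (a := c), mul_ite, mul_one, mul_zero]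

variable (ψ : AddChar H ℂ)

theorem addChar_card_fiber_eq [DecidableEq ℂ] (b : H) :
    #{a : H | ψ a = ψ b} = #{a : H | ψ a = 1} := by
  refine card_nbij' (fun a => a - b) (fun a => a + b) ?_ ?_ ?_ ?_
  · intro a ha
    have h0 : ψ b ≠ 0 := by
      intro h
      simpa [h] using AddChar.norm_apply ψ b
    simp only [coe_filter, mem_univ, true_and, Set.mem_ofPred_eq] at ha ⊢
    have : ψ (a - b) * ψ b = 1 * ψ b := by
      rw [← AddChar.map_add_eq_mul, sub_add_cancel, ha, one_mul]
    exact mul_right_cancel₀ h0 this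
  · intro a ha
    simp only [coe_filter, mem_univ, true_and, Set.mem_ofPred_eq] at ha ⊢
    rw [AddChar.map_add_eq_mul, ha, one_mul]
  · intro a _
    simp
  · intro a _
    simp

theorem addChar_card_eq_mul [DecidableEq ℂ] :
    Fintype.card H = #(univ.image ψ) * #{a : H | ψ a = 1} := by
  rw [← card_univ, card_eq_sum_card_image ψ univ, ← smul_eq_mul, ← sum_const]
  refine sum_congr rfl fun w hw => ?_
  obtain ⟨b, -, rfl⟩ := mem_image.1 hw
  exact addChar_card_fiber_eq ψ b

theorem addChar_pow_card_image_eq_one [DecidableEq ℂ] (b : H) :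
    ψ b ^ #(univ.image ψ) = 1 := by
  have hne : ∀ a, ψ a ≠ 0 := by
    intro a h
    simpa [h] using AddChar.norm_apply ψ a
  have hprod : ∏ w ∈ univ.image ψ, w ≠ 0 := by
    rw [prod_ne_zero_iff]
    intro w hw
    obtain ⟨a, -, rfl⟩ := mem_image.1 hw
    exact hne a
  have hinj : Set.InjOn (fun w => ψ b * w) (univ.image ψ : Finset ℂ) :=
    (mul_right_injective₀ (hne b)).injOn
  have himage : (univ.image ψ).image (fun w => ψ b * w) = univ.image ψ := by
    refine eq_of_subset_of_card_le ?_ (card_image_of_injOn hinj).ge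
    intro w hw
    obtain ⟨v, hv, rfl⟩ := mem_image.1 hw
    obtain ⟨a, -, rfl⟩ := mem_image.1 hv
    exact mem_image.2 ⟨b + a, mem_univ _, AddChar.map_add_eq_mul ψ b a⟩
  have h := prod_image (f := fun w : ℂ => w) hinj
  rw [himage, prod_mul_distrib, prod_const] at h
  exact mul_right_cancel₀ hprod (h.symm.trans (one_mul _).symm)

open Polynomial in
theorem addChar_prod_X_sub_C [DecidableEq ℂ] :
    ∏ a : H, (X - C (ψ a)) = (X ^ #(univ.image ψ) - 1) ^ #{a : H | ψ a = 1} := by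
  have hroots : ∏ w ∈ univ.image ψ, (X - C w) = X ^ #(univ.image ψ) - 1 := by
    have hpos : #(univ.image ψ) ≠ 0 :=
      (card_pos.2 ⟨ψ 0, mem_image_of_mem _ (mem_univ _)⟩).ne'
    have hm : (∏ w ∈ univ.image ψ, (X - C w)).Monic :=
      monic_prod_of_monic _ _ fun w _ => monic_X_sub_C w
    have hdeg : (∏ w ∈ univ.image ψ, (X - C w)).degree =
        ((#(univ.image ψ) : ℕ) : WithBot ℕ) := by
      rw [degree_prod]
      simp
    have hm' : (X ^ #(univ.image ψ) - 1 : ℂ[X]).Monic := monic_X_pow_sub_C 1 hpos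
    have hdeg' : (X ^ #(univ.image ψ) - 1 : ℂ[X]).degree =
        ((#(univ.image ψ) : ℕ) : WithBot ℕ) :=
      degree_X_pow_sub_C (Nat.pos_of_ne_zero hpos) 1
    refine eq_of_degree_sub_lt_of_eval_finset_eq (univ.image ψ) ?_ ?_
    · rw [← hdeg]
      exact degree_sub_lt_left (hdeg.trans hdeg'.symm) hm.ne_zero
        (hm.leadingCoeff.trans hm'.leadingCoeff.symm)
    · intro w hw
      rw [eval_prod, prod_eq_zero hw (by simp)]
      obtain ⟨a, -, rfl⟩ := mem_image.1 hw
      simp [addChar_pow_card_image_eq_one]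
  rw [prod_comp (fun w => X - C w) ψ, ← hroots, ← prod_pow]
  refine prod_congr rfl fun w hw => ?_
  obtain ⟨b, -, rfl⟩ := mem_image.1 hw
  rw [addChar_card_fiber_eq]

/-- The elementary symmetric functions of the values of a character, up to sign. -/
theorem norm_sum_powersetCard_addChar [DecidableEq ℂ] {j : ℕ} (hj : j ≤ Fintype.card H) :
    ‖∑ s ∈ powersetCard j (univ : Finset H), ∏ x ∈ s, ψ x‖ =
      if #(univ.image ψ) ∣ j then
        ((#{a : H | ψ a = 1}).choose (j / #(univ.image ψ)) : ℝ) else 0 := by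
  set m := #(univ.image ψ) with hm
  set N := #{a : H | ψ a = 1}
  have hmpos : 0 < m := by
    rw [hm]
    exact card_pos.2 ⟨ψ 0, mem_image_of_mem _ (mem_univ _)⟩
  have hcard : Fintype.card H = m * N := addChar_card_eq_mul ψ
  have hcoeff := prod_X_add_C_coeff (univ : Finset H) (fun a => -ψ a)
    (k := Fintype.card H - j) (by rw [card_univ]; omega)
  rw [card_univ, Nat.sub_sub_self hj] at hcoeff
  have hsign : ∀ s ∈ powersetCard j (univ : Finset H),
      ∏ x ∈ s, -ψ x = (-1) ^ j * ∏ x ∈ s, ψ x := by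
    intro s hs
    rw [prod_neg, (mem_powersetCard.1 hs).2]
  rw [sum_congr rfl hsign, ← mul_sum] at hcoeff
  have hpoly : ∏ a : H, (Polynomial.X + Polynomial.C (-ψ a)) =
      Polynomial.expand ℂ m ((Polynomial.X + Polynomial.C (-1)) ^ N) := by
    simp only [map_neg, ← sub_eq_add_neg, map_one, map_pow, map_sub, Polynomial.expand_X]
    exact addChar_prod_X_sub_C ψ
  rw [hpoly, Polynomial.coeff_expand hmpos, Polynomial.coeff_X_add_C_pow] at hcoeff
  have hnorm := congrArg norm hcoeff
  rw [norm_mul, norm_pow, norm_neg, norm_one, one_pow, one_mul] at hnorm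
  rw [← hnorm]
  have hdvd : m ∣ Fintype.card H - j ↔ m ∣ j := by
    rw [Nat.dvd_sub_iff_right hj (hcard ▸ dvd_mul_right m N)]
  by_cases h : m ∣ j
  · rw [if_pos (hdvd.2 h), if_pos h]
    obtain ⟨k, rfl⟩ := h
    have hk : k ≤ N := by
      rw [hcard] at hj
      exact Nat.le_of_mul_le_mul_left hj hmpos
    rw [hcard, ← Nat.mul_sub, Nat.mul_div_cancel_left _ hmpos, Nat.mul_div_cancel_left _ hmpos,
      Nat.choose_symm hk]
    simp
  · rw [if_neg (fun h' => h (hdvd.1 h')), if_neg h, norm_zero]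

end Characters

section Torsion

theorem addCircle_card_nsmul_eq_zero_le {e : ℕ} (he : 0 < e) (T : Finset (AddCircle (1 : ℝ)))
    (hT : ∀ x ∈ T, e • x = 0) : #T ≤ e := by
  classical
  have hinj : Function.Injective fun x : AddCircle (1 : ℝ) => (x.toCircle : ℂ) :=
    Subtype.val_injective.comp (AddCircle.injective_toCircle one_ne_zero)
  rw [← card_image_of_injective T hinj]
  refine le_trans ?_ ((Multiset.toFinset_card_le _).trans (Polynomial.card_nthRoots e (1 : ℂ)))
  refine card_le_card fun z hz => ?_
  obtain ⟨x, hx, rfl⟩ := mem_image.1 hz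
  rw [Multiset.mem_toFinset, Polynomial.mem_nthRoots he, ← Circle.coe_pow,
    ← AddCircle.toCircle_nsmul, hT x hx]
  simp

theorem card_nsmul_eq_zero_le_of_injective {H : Type*} [AddCommGroup H] [Fintype H]
    [DecidableEq H] (f : H →+ AddCircle (1 : ℝ) × ZMod 2) (hf : Function.Injective f)
    {e : ℕ} (he : 0 < e) : #{x : H | e • x = 0} ≤ 2 * e := by
  classical
  set S : Finset H := {x : H | e • x = 0}
  have hsub : S.image f ⊆ (S.image fun x => (f x).1) ×ˢ univ := by
    intro y hy
    obtain ⟨x, hx, rfl⟩ := mem_image.1 hy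
    exact mem_product.2 ⟨mem_image_of_mem (fun x => (f x).1) hx, mem_univ _⟩
  have hle := card_le_card hsub
  rw [card_image_of_injective S hf, card_product, card_univ, ZMod.card] at hle
  have hT : #(S.image fun x => (f x).1) ≤ e := by
    refine addCircle_card_nsmul_eq_zero_le he _ fun y hy => ?_
    obtain ⟨x, hx, rfl⟩ := mem_image.1 hy
    have hx0 : e • x = 0 := (mem_filter.1 hx).2
    have := congrArg Prod.fst (congrArg f hx0)
    simpa using this
  omega

/-- A finite abelian group and its character group have equally many `e`-torsion elements. -/
theorem card_addChar_pow_eq_one {H : Type*} [AddCommGroup H] [Fintype H] [DecidableEq H]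
    [DecidableEq (AddChar H ℂ)] (e : ℕ) : #{ψ : AddChar H ℂ | ψ ^ e = 1} = #{x : H | e • x = 0} := by
  obtain ⟨E⟩ := CommGroup.monoidHom_mulEquiv_of_hasEnoughRootsOfUnity (Multiplicative H) ℂ
  let D : AddChar H ℂ ≃* (Multiplicative H →* ℂˣ) :=
    AddChar.toMonoidHomMulEquiv.trans MonoidHom.toHomUnitsMulEquiv
  let F := D.trans E
  refine card_nbij' (fun ψ => (F ψ).toAdd) (fun x => F.symm (Multiplicative.ofAdd x)) ?_ ?_ ?_ ?_
  · intro ψ hψ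
    simp only [coe_filter, mem_univ, true_and, Set.mem_ofPred_eq] at hψ ⊢
    rw [← toAdd_pow, ← map_pow, hψ, map_one, toAdd_one]
  · intro x hx
    simp only [coe_filter, mem_univ, true_and, Set.mem_ofPred_eq] at hx ⊢
    rw [← map_pow, ← ofAdd_nsmul, hx, ofAdd_zero, map_one]
  · intro ψ _
    simp
  · intro x _
    simp

end Torsion

section Binomials

theorem two_pow_mul_choose_le (N j : ℕ) : 2 ^ j * N.choose j ≤ (2 * N).choose j := by
  have hdesc : 2 ^ j * N.descFactorial j ≤ (2 * N).descFactorial j := by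
    induction j with
    | zero => simp
    | succ j ih =>
      rw [Nat.descFactorial_succ, Nat.descFactorial_succ, pow_succ]
      calc 2 ^ j * 2 * ((N - j) * N.descFactorial j)
          = (2 * (N - j)) * (2 ^ j * N.descFactorial j) := by ring
        _ ≤ (2 * N - j) * (2 * N).descFactorial j := Nat.mul_le_mul (by omega) ih
  rw [Nat.descFactorial_eq_factorial_mul_choose, Nat.descFactorial_eq_factorial_mul_choose] at hdesc
  refine le_of_mul_le_mul_left ?_ j.factorial_pos
  linarith

theorem le_choose_of_pos_of_lt {M r : ℕ} (hr : 0 < r) (hM : r < M) : M ≤ M.choose r := by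
  induction M generalizing r with
  | zero => omega
  | succ M ih =>
    obtain ⟨r, rfl⟩ := Nat.exists_eq_add_of_lt hr
    rw [zero_add, Nat.choose_succ_succ]
    rcases Nat.eq_zero_or_pos r with rfl | hr'
    · simp [add_comm]
    · have h1 := ih hr' (by omega)
      have h2 : 0 < M.choose (r + 1) := Nat.choose_pos (by omega)
      simp only [Nat.succ_eq_add_one]
      omega

theorem choose_mul_choose_le_choose (a b i j : ℕ) :
    a.choose i * b.choose j ≤ (a + b).choose (i + j) := by
  rw [Nat.add_choose_eq]
  exact single_le_sum (f := fun ij : ℕ × ℕ => a.choose ij.1 * b.choose ij.2)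
    (fun _ _ => Nat.zero_le _) (mem_antidiagonal.2 rfl : (i, j) ∈ antidiagonal (i + j))

theorem choose_mul_le_choose_half {m k N : ℕ} (hm : 3 ≤ m) (hkN : k ≤ N) :
    N.choose k * (m * (k + 1)) ≤ 15 * (m * (N + 1)).choose (m * (k + 1) / 2 - 2) := by
  have hNm : 3 * (N + 1) ≤ m * (N + 1) := Nat.mul_le_mul_right _ hm
  have hkm : 3 * (k + 1) ≤ m * (k + 1) := Nat.mul_le_mul_right _ hm
  have hkNm : m * (k + 1) ≤ m * (N + 1) := Nat.mul_le_mul_left _ (by omega)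
  by_cases hsmall : m * (k + 1) ≤ 3
  · have hk : k = 0 := by omega
    subst hk
    have hm3 : m = 3 := by omega
    subst hm3
    simp
  obtain ⟨r, hr⟩ : ∃ r, m * (k + 1) / 2 - 2 = k + r := ⟨m * (k + 1) / 2 - 2 - k, by omega⟩
  obtain ⟨M, hM⟩ : ∃ M, m * (N + 1) = N + M := ⟨m * (N + 1) - N, by omega⟩
  have hprod := choose_mul_choose_le_choose N M k r
  have hbound : m * (k + 1) ≤ 15 * M.choose r := by
    rcases Nat.eq_zero_or_pos r with rfl | hrpos
    · rw [Nat.choose_zero_right]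
      omega
    · have := le_choose_of_pos_of_lt hrpos (show r < M by omega)
      omega
  rw [hr, hM]
  calc N.choose k * (m * (k + 1)) ≤ N.choose k * (15 * M.choose r) := Nat.mul_le_mul_left _ hbound
    _ = 15 * (N.choose k * M.choose r) := by ring
    _ ≤ _ := Nat.mul_le_mul_left _ hprod

end Binomials

section Error

variable {H : Type*} [AddCommGroup H] [Fintype H]

theorem addChar_mul_norm_sum_powersetCard_le [DecidableEq (AddChar H ℂ)] {d : ℕ}
    {ψ : AddChar H ℂ} (hψ : ψ ≠ 1) :
    ((d : ℝ) + 1) * ‖∑ s ∈ powersetCard (d + 1) (univ : Finset H), ∏ x ∈ s, ψ x‖ ≤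
      Fintype.card H *
        ((if ψ ^ 2 = 1 then
            (if Odd d then
              2 * ((2 : ℝ) ^ (-(d : ℝ) / 2) * (Fintype.card H).choose ((d - 1) / 2)) else 0)
          else 0) +
          if ψ ^ (d + 1) = 1 then
            15 * ((Fintype.card H).choose ((d + 1) / 2 - 2) : ℝ) / (d + 1) else 0) := by
  classical
  have hRHS : 0 ≤ (Fintype.card H : ℝ) *
        ((if ψ ^ 2 = 1 then
            (if Odd d then
              2 * ((2 : ℝ) ^ (-(d : ℝ) / 2) * (Fintype.card H).choose ((d - 1) / 2)) else 0)
          else 0) +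
          if ψ ^ (d + 1) = 1 then
            15 * ((Fintype.card H).choose ((d + 1) / 2 - 2) : ℝ) / (d + 1) else 0) := by
    positivity
  rcases lt_or_ge (Fintype.card H) (d + 1) with hlt | hle
  · rw [powersetCard_eq_empty.2 (by rwa [card_univ])]
    simpa using hRHS
  rw [norm_sum_powersetCard_addChar ψ hle]
  have hcard := addChar_card_eq_mul ψ
  have hpow := addChar_pow_card_image_eq_one ψ
  set m := #(univ.image ψ)
  set N := #{a : H | ψ a = 1}
  by_cases hdvd : m ∣ d + 1
  swap
  · rw [if_neg hdvd, mul_zero]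
    exact hRHS
  have hpow_eq : ∀ e, m ∣ e → ψ ^ e = 1 := by
    rintro e ⟨k, rfl⟩
    ext a
    rw [AddChar.pow_apply, pow_mul, hpow, one_pow, AddChar.one_apply]
  have hm1 : m ≠ 1 := fun h => hψ (by simpa using hpow_eq 1 (by simp [h]))
  rw [if_pos hdvd, if_pos (hpow_eq _ hdvd)]
  obtain ⟨k, hk⟩ := hdvd
  have hm0 : 0 < m := Nat.pos_of_ne_zero fun h => by simp [h] at hk
  obtain ⟨k, rfl⟩ : ∃ k', k = k' + 1 :=
    Nat.exists_eq_succ_of_ne_zero fun h => by simp [h] at hk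
  rw [hk, hcard] at hle
  have hkN := Nat.le_of_mul_le_mul_left hle hm0
  rw [hk, Nat.mul_div_cancel_left _ hm0]
  obtain ⟨N', hN'⟩ : ∃ N', N = N' + 1 := ⟨N - 1, by omega⟩
  rw [hN'] at hcard hkN ⊢
  have hd : (d : ℝ) + 1 = m * (k + 1) := by exact_mod_cast hk
  have hsucc : ((N' : ℝ) + 1) * N'.choose k = (N' + 1).choose (k + 1) * (k + 1) := by
    exact_mod_cast Nat.add_one_mul_choose_eq N' k
  have hLHS : ((d : ℝ) + 1) * (N' + 1).choose (k + 1) = Fintype.card H * N'.choose k := by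
    rw [hd, hcard]
    push_cast
    linear_combination (-(m : ℝ)) * hsucc
  rw [hLHS]
  refine mul_le_mul_of_nonneg_left ?_ (Nat.cast_nonneg _)
  rcases (show m = 2 ∨ 3 ≤ m by omega) with hm2 | hm3
  · rw [hm2] at hk hcard
    have hodd : Odd d := ⟨k, by omega⟩
    rw [if_pos (hpow_eq 2 (by simp [hm2])), if_pos hodd, hcard, show (d - 1) / 2 = k by omega]
    refine le_add_of_le_of_nonneg ?_ (by positivity)
    have hdk : (d : ℝ) = 2 * k + 1 := by exact_mod_cast (show d = 2 * k + 1 by omega)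
    have hchoose : (2 : ℝ) ^ k * N'.choose k ≤ (2 * (N' + 1)).choose k := by
      exact_mod_cast (Nat.mul_le_mul_left _ (Nat.choose_le_choose k N'.le_succ)).trans
        (two_pow_mul_choose_le (N' + 1) k)
    have hexp : (1 : ℝ) ≤ 2 * 2 ^ (-(d : ℝ) / 2) * 2 ^ k := by
      rw [← Real.rpow_natCast 2 k]
      nth_rewrite 1 [← Real.rpow_one 2]
      rw [← Real.rpow_add two_pos, ← Real.rpow_add two_pos]
      refine Real.one_le_rpow one_le_two ?_
      rw [hdk]
      linarith
    calc (N'.choose k : ℝ) ≤ 2 * 2 ^ (-(d : ℝ) / 2) * 2 ^ k * N'.choose k :=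
          le_mul_of_one_le_left (Nat.cast_nonneg _) hexp
      _ = 2 * 2 ^ (-(d : ℝ) / 2) * (2 ^ k * N'.choose k) := by ring
      _ ≤ 2 * 2 ^ (-(d : ℝ) / 2) * (2 * (N' + 1)).choose k := by gcongr
      _ = _ := by ring
  · refine le_add_of_nonneg_of_le (by positivity) ?_
    have h := choose_mul_le_choose_half hm3 (show k ≤ N' by omega)
    rw [le_div_iff₀ (by positivity), hd, hcard]
    exact_mod_cast h

theorem sum_addChar_mul_norm_le [DecidableEq (AddChar H ℂ)] (d : ℕ)
    (f : H →+ AddCircle (1 : ℝ) × ZMod 2) (hf : Function.Injective f) :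
    ((d : ℝ) + 1) * ∑ ψ ∈ univ.erase (1 : AddChar H ℂ),
        ‖∑ s ∈ powersetCard (d + 1) (univ : Finset H), ∏ x ∈ s, ψ x‖ ≤
      Fintype.card H *
        (8 * (if Odd d then (2 : ℝ) ^ (-(d : ℝ) / 2) * (Fintype.card H).choose ((d - 1) / 2)
            else 0) + 30 * (Fintype.card H).choose ((d + 1) / 2 - 2)) := by
  classical
  have htors : ∀ e : ℕ, 0 < e → (#{ψ : AddChar H ℂ | ψ ^ e = 1} : ℝ) ≤ 2 * e := by
    intro e he
    rw [card_addChar_pow_eq_one]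
    exact_mod_cast card_nsmul_eq_zero_le_of_injective f hf he
  have hite : ∀ (e : ℕ) (x : ℝ), ∑ ψ : AddChar H ℂ, (if ψ ^ e = 1 then x else 0) =
      #{ψ : AddChar H ℂ | ψ ^ e = 1} * x := by
    intro e x
    rw [← sum_filter, sum_const, nsmul_eq_mul]
  set B : ℝ := if Odd d then
    2 * ((2 : ℝ) ^ (-(d : ℝ) / 2) * (Fintype.card H).choose ((d - 1) / 2)) else 0 with hB
  set K : ℝ := 15 * ((Fintype.card H).choose ((d + 1) / 2 - 2) : ℝ) / (d + 1) with hK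
  have hB0 : 0 ≤ B := by positivity
  have hK0 : 0 ≤ K := by positivity
  rw [mul_sum]
  calc ∑ ψ ∈ univ.erase (1 : AddChar H ℂ),
        ((d : ℝ) + 1) * ‖∑ s ∈ powersetCard (d + 1) (univ : Finset H), ∏ x ∈ s, ψ x‖
      ≤ ∑ ψ ∈ univ.erase (1 : AddChar H ℂ), (Fintype.card H : ℝ) *
          ((if ψ ^ 2 = 1 then B else 0) + if ψ ^ (d + 1) = 1 then K else 0) :=
        sum_le_sum fun ψ hψ => addChar_mul_norm_sum_powersetCard_le (ne_of_mem_erase hψ)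
    _ ≤ ∑ ψ : AddChar H ℂ, (Fintype.card H : ℝ) *
          ((if ψ ^ 2 = 1 then B else 0) + if ψ ^ (d + 1) = 1 then K else 0) :=
        sum_le_sum_of_subset_of_nonneg (erase_subset _ _) fun _ _ _ => by positivity
    _ = Fintype.card H * (#{ψ : AddChar H ℂ | ψ ^ 2 = 1} * B +
          #{ψ : AddChar H ℂ | ψ ^ (d + 1) = 1} * K) := by
        rw [← mul_sum, sum_add_distrib, hite, hite]
    _ ≤ Fintype.card H * ((2 * (2 : ℕ)) * B + (2 * (d + 1 : ℕ)) * K) := by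
        gcongr
        · exact htors 2 two_pos
        · exact htors (d + 1) d.succ_pos
    _ = _ := by
        rw [hB, hK]
        push_cast
        split_ifs <;> field_simp <;> ring

/-- The deviation of the count from its main term is controlled by the nontrivial characters. -/
theorem card_mul_abs_card_doubled_sub_le [DecidableEq H] [DecidableEq (AddChar H ℂ)] {d : ℕ}
    (i : Fin d) (c : H) :
    (Fintype.card H : ℝ) *
        |(#{a : Fin d → H | Function.Injective a ∧ a i + ∑ k, a k = c} : ℝ) -
          (d - 1).factorial * (Fintype.card H - 1).choose (d - 1)| ≤
      (d - 1).factorial * (((d : ℝ) + 1) * ∑ ψ ∈ univ.erase (1 : AddChar H ℂ),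
        ‖∑ s ∈ powersetCard (d + 1) (univ : Finset H), ∏ x ∈ s, ψ x‖) := by
  have hcount := descFactorial_eq_card_add_mul_card i c
  rw [card_injective_tuples_sum_eq] at hcount
  have hfourier := card_mul_card_powersetCard_sum_eq (d + 1) c
  set X := #{a : Fin d → H | Function.Injective a ∧ a i + ∑ k, a k = c}
  set S := #{s ∈ powersetCard (d + 1) (univ : Finset H) | ∑ x ∈ s, x = c}
  rw [← add_sum_erase _ _ (mem_univ (1 : AddChar H ℂ))] at hfourier
  simp only [AddChar.one_apply, prod_const_one, sum_const, card_powersetCard, card_univ,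
    one_mul, nsmul_eq_mul, mul_one] at hfourier
  obtain ⟨e, rfl⟩ : ∃ e, d = e + 1 := ⟨d - 1, by have := i.2; omega⟩
  obtain ⟨n, hn⟩ : ∃ n, Fintype.card H = n + 1 :=
    Nat.exists_eq_succ_of_ne_zero Fintype.card_ne_zero
  have hnorm : |((n : ℝ) + 1) * S - (n + 1).choose (e + 1 + 1)| ≤
      ∑ ψ ∈ univ.erase (1 : AddChar H ℂ),
        ‖∑ s ∈ powersetCard (e + 1 + 1) (univ : Finset H), ∏ x ∈ s, ψ x‖ := by
    rw [hn, ← sub_eq_iff_eq_add'] at hfourier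
    have h := (norm_sum_le (univ.erase (1 : AddChar H ℂ)) fun ψ => ψ (-c) *
      ∑ s ∈ powersetCard (e + 1 + 1) (univ : Finset H), ∏ x ∈ s, ψ x)
    simp only [norm_mul, AddChar.norm_apply, one_mul] at h
    rw [← hfourier] at h
    rw [← Real.norm_eq_abs, ← Complex.norm_real]
    push_cast at h ⊢
    exact h
  rw [hn] at hcount ⊢
  simp only [Nat.add_sub_cancel]
  rw [Nat.succ_descFactorial_succ] at hcount
  have hP : n.descFactorial e = e.factorial * n.choose e :=
    Nat.descFactorial_eq_factorial_mul_choose n e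
  have hC : ((e + 1 + 1).factorial : ℝ) * (n + 1).choose (e + 1 + 1) =
      ((n : ℝ) - e) * ((n + 1) * (e.factorial * n.choose e)) := by
    have h : (e + 1 + 1).factorial * (n + 1).choose (e + 1 + 1) =
        (n - e) * ((n + 1) * (e.factorial * n.choose e)) := by
      rw [← Nat.descFactorial_eq_factorial_mul_choose, Nat.succ_descFactorial_succ,
        Nat.descFactorial_succ, hP]
      ring
    rcases le_or_gt e n with hen | hen
    · have h' := congrArg (Nat.cast (R := ℝ)) h
      push_cast [Nat.cast_sub hen] at h' ⊢
      exact h'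
    · rw [Nat.choose_eq_zero_of_lt hen, Nat.choose_eq_zero_of_lt (by omega)]
      simp
  rw [hP] at hcount
  have hcount' : ((n : ℝ) + 1) * (e.factorial * n.choose e) =
      (e + 1 + 1).factorial * S + (e + 1) * X := by exact_mod_cast hcount
  have hfac : ((e + 1 + 1).factorial : ℝ) = (e + 2) * ((e + 1) * e.factorial) := by
    rw [Nat.factorial_succ, Nat.factorial_succ]
    push_cast
    ring
  have hdev : ((n : ℝ) + 1) * (X - e.factorial * n.choose e) =
      -(e.factorial * (e + 2) * ((n + 1) * S - (n + 1).choose (e + 1 + 1))) := by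
    have he : (e : ℝ) + 1 ≠ 0 := by positivity
    rw [hfac] at hC hcount'
    refine mul_left_cancel₀ he ?_
    linear_combination (-(n : ℝ) - 1) * hcount' - hC
  have habs : (((n + 1 : ℕ) : ℝ)) * |(X : ℝ) - e.factorial * n.choose e| =
      e.factorial * (e + 2) * |((n : ℝ) + 1) * S - (n + 1).choose (e + 1 + 1)| := by
    rw [← abs_of_nonneg (show (0 : ℝ) ≤ ((n + 1 : ℕ) : ℝ) by positivity), ← abs_mul]
    push_cast
    rw [hdev, abs_neg, abs_mul, abs_of_nonneg (show (0 : ℝ) ≤ e.factorial * (e + 2) by positivity)]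
  rw [habs, mul_assoc]
  push_cast
  rw [show (e : ℝ) + 1 + 1 = e + 2 by ring]
  gcongr

end Error

/-- Lemma 5.6.
Let `d ≥ 2` and let `H` be a finite subgroup of `ℝ/ℤ` or of `ℝ/ℤ × ℤ₂` of order `n`. Then
for every `c ∈ H`, the number `[2, 1, …, 1; c]` (with `d - 1` ones) of ordered `d`-tuples
`(a₁, …, a_d)` of pairwise distinct elements of `H` with `2a₁ + a₂ + ⋯ + a_d = c` equals
`(d-1)!·(C(n-1, d-1) + ε(d, n))`, where
`|ε(d, n)| = O(2^{-d/2}·C(n, (d-1)/2) + C(n, (d-3)/2))` if `d` is odd, and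
`|ε(d, n)| = O(d·2^{-d/2}·C(n, d/2-1) + C(n, d/2-2))` if `d` is even. -/
theorem count_two_one_one_tuples :
    ∃ C : ℝ, 0 < C ∧ ∀ d : ℕ, ∀ hd : 2 ≤ d,
      ∀ (H : Type) [inst : AddCommGroup H] [inst2 : Fintype H], ∀ n : ℕ,
        Fintype.card H = n →
        (∃ f : H →+ AddCircle (1 : ℝ) × ZMod 2, Function.Injective f) →
        ∀ c : H,
          |(({a : Fin d → H | Function.Injective a ∧ a ⟨0, by omega⟩ + ∑ i, a i = c}.ncard : ℝ)) -
              ((d - 1).factorial : ℝ) * ((n - 1).choose (d - 1))| ≤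
            ((d - 1).factorial : ℝ) *
              (if Odd d then
                C * ((2 : ℝ) ^ (-(d : ℝ) / 2) * (n.choose ((d - 1) / 2)) +
                  (n.choose ((d - 3) / 2)))
              else
                C * ((d : ℝ) * (2 : ℝ) ^ (-(d : ℝ) / 2) * (n.choose (d / 2 - 1)) +
                  (n.choose (d / 2 - 2)))) := by
  refine ⟨30, by norm_num, ?_⟩
  rintro d hd H _ _ n rfl ⟨f, hf⟩ c
  classical
  have hset : ({a : Fin d → H | Function.Injective a ∧ a ⟨0, by omega⟩ + ∑ i, a i = c} :
      Set (Fin d → H)) = (({a : Fin d → H | Function.Injective a ∧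
        a ⟨0, by omega⟩ + ∑ i, a i = c} : Finset (Fin d → H)) : Set (Fin d → H)) := by
    ext a
    simp
  rw [hset, Set.ncard_coe_finset]
  have hpos : (0 : ℝ) < Fintype.card H := by exact_mod_cast Fintype.card_pos
  have hdev := card_mul_abs_card_doubled_sub_le (⟨0, by omega⟩ : Fin d) c
  have hsum := mul_le_mul_of_nonneg_left (sum_addChar_mul_norm_le d f hf)
    (Nat.cast_nonneg (α := ℝ) (d - 1).factorial)
  have hle := hdev.trans hsum
  rw [mul_left_comm] at hle
  refine (le_of_mul_le_mul_left hle hpos).trans ?_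
  refine mul_le_mul_of_nonneg_left ?_ (Nat.cast_nonneg _)
  split_ifs with hodd
  · obtain ⟨k, rfl⟩ := hodd
    rw [show (2 * k + 1 + 1) / 2 - 2 = (2 * k + 1 - 3) / 2 by omega]
    have : (0 : ℝ) ≤ (2 : ℝ) ^ (-((2 * k + 1 : ℕ) : ℝ) / 2) *
      (Fintype.card H).choose ((2 * k + 1 - 1) / 2) := by positivity
    linarith
  · rw [Nat.not_odd_iff_even] at hodd
    obtain ⟨k, rfl⟩ := hodd
    rw [show (k + k + 1) / 2 - 2 = (k + k) / 2 - 2 by omega]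
    have : (0 : ℝ) ≤ ((k + k : ℕ) : ℝ) * (2 : ℝ) ^ (-((k + k : ℕ) : ℝ) / 2) *
      (Fintype.card H).choose ((k + k) / 2 - 1) := by positivity
    linarith
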